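/- Let n ≥ 2 and let f : ℝⁿ → ℝ be a polynomial of total degree at most d (d ≥ 1) whose restriction to the unit sphere S^{n−1} = {x ∈ ℝⁿ | |x| = 1} is not identically zero. Then the number of connected components of the set {x ∈ S^{n−1} | f(x) ≠ 0} (with the subspace topology) is at most 2^{2n−1} · d^{n−1}. -/

import Mathlib

open MvPolynomial

/-- Every value pattern on finitely many distinct points is interpolated by a polynomial. -/
theorem MvPolynomial.span_eval_eq_top {σ ι : Type*} [Fintype σ] [Fintype ι]
    {z : ι → σ → ℝ} (hz : Function.Injective z) :
    Submodule.span ℝ (Set.range fun (p : MvPolynomial σ ℝ) (a : ι) => eval (z a) p) = ⊤ := by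
  classical
  rw [eq_top_iff, ← (Pi.basisFun ℝ ι).span_eq, Submodule.span_le]
  rintro _ ⟨a, rfl⟩
  let p : MvPolynomial σ ℝ := ∏ b ∈ Finset.univ.erase a, ∑ i, (X i - C (z b i)) ^ 2
  have hpa : eval (z a) p ≠ 0 := by
    simp only [p, map_prod, map_sum, map_pow, map_sub, eval_X, eval_C]
    refine Finset.prod_ne_zero_iff.2 fun b hb h => ?_
    rw [Finset.sum_eq_zero_iff_of_nonneg fun i _ => sq_nonneg _] at h
    have hzab : z b = z a := by
      ext i
      have := h i (Finset.mem_univ i)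
      linarith [pow_eq_zero_iff (two_ne_zero) |>.1 this]
    exact Finset.ne_of_mem_erase hb (hz hzab)
  have hpb : ∀ b, b ≠ a → eval (z b) p = 0 := by
    intro b hb
    simp only [p, map_prod, map_sum, map_pow, map_sub, eval_X, eval_C]
    exact Finset.prod_eq_zero (Finset.mem_erase.2 ⟨hb, Finset.mem_univ b⟩) (by simp)
  have : Pi.basisFun ℝ ι a = (eval (z a) p)⁻¹ • fun b => eval (z b) p := by
    ext b
    by_cases hb : b = a
    · subst hb; simp [hpa]
    · simp [hb, hpb]
  rw [this]
  exact Submodule.smul_mem _ _ (Submodule.subset_span ⟨p, rfl⟩)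

/-- A polynomial system `c xᵢ^D = qᵢ(x)` with `deg qᵢ < D` has at most `D ^ #σ` solutions. -/
theorem MvPolynomial.card_le_of_pow_eq {σ ι : Type*} [Fintype σ] [Fintype ι]
    {z : ι → σ → ℝ} (hz : Function.Injective z) {D : ℕ} {c : ℝ} (hc : c ≠ 0)
    (q : σ → MvPolynomial σ ℝ) (hq : ∀ i, (q i).totalDegree < D)
    (h : ∀ a i, c * z a i ^ D = eval (z a) (q i)) :
    Fintype.card ι ≤ D ^ Fintype.card σ := by
  classical
  let g : (σ → Fin D) → ι → ℝ := fun e a => ∏ i, z a i ^ (e i : ℕ)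
  let W := Submodule.span ℝ (Set.range g)
  have key : ∀ n (p : MvPolynomial σ ℝ), p.totalDegree < n → (fun a => eval (z a) p) ∈ W := by
    intro n
    induction n with
    | zero => intro p hp; omega
    | succ n ih =>
      intro p hp
      have hp' : (fun a => eval (z a) p) =
          ∑ s ∈ p.support, coeff s p • fun a => ∏ i, z a i ^ s i := by
        ext a
        simp [eval_eq']
      rw [hp']
      refine Submodule.sum_mem _ fun s hs => Submodule.smul_mem _ _ ?_
      by_cases hsD : ∀ i, s i < D
      · exact Submodule.subset_span ⟨fun i => ⟨s i, hsD i⟩, rfl⟩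
      · push Not at hsD
        obtain ⟨i, hi⟩ := hsD
        have hle : Finsupp.single i D ≤ s := by simpa using hi
        obtain ⟨t, rfl⟩ := exists_add_of_le hle
        have heq : (fun a => ∏ j, z a j ^ (Finsupp.single i D + t) j) =
            c⁻¹ • fun a => eval (z a) (q i * monomial t 1) := by
          ext a
          have h1 : ∏ j, z a j ^ (Finsupp.single i D) j = z a i ^ D := by
            rw [Finset.prod_eq_single i]
            · simp
            · intro b _ hb; simp [hb.symm]
            · simp
          have h2 : eval (z a) (monomial t 1) = ∏ j, z a j ^ t j := by
            simp [eval_monomial, Finsupp.prod_fintype]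
          simp only [Finsupp.add_apply, pow_add, Finset.prod_mul_distrib, h1, Pi.smul_apply,
            map_mul, h2, ← h a i, smul_eq_mul]
          field_simp
        rw [heq]
        refine Submodule.smul_mem _ _ (ih _ ?_)
        have h3 := le_totalDegree hs
        rw [Finsupp.sum_add_index' (by simp) (by simp), Finsupp.sum_single_index rfl] at h3
        have h4 := totalDegree_mul (q i) (monomial t 1)
        have h5 := totalDegree_monomial_le t (1 : ℝ)
        have := hq i
        change _ ≤ t.sum fun _ e => e at h5
        omega
  have hW : W = ⊤ := by
    rw [eq_top_iff, ← span_eval_eq_top hz, Submodule.span_le]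
    rintro _ ⟨p, rfl⟩
    exact key _ p (Nat.lt_succ_self _)
  have h1 := finrank_range_le_card (R := ℝ) g
  rw [Set.finrank, show Submodule.span ℝ (Set.range g) = ⊤ from hW, finrank_top] at h1
  simpa using h1

theorem MvPolynomial.totalDegree_pderiv_le {σ : Type*} (i : σ) (p : MvPolynomial σ ℝ) :
    (pderiv i p).totalDegree ≤ p.totalDegree := by
  classical
  rw [totalDegree_eq (pderiv i p)]
  refine Finset.sup_le fun s hs => ?_
  rw [mem_support_iff, coeff_pderiv] at hs
  have hs' : s + Finsupp.single i 1 ∈ p.support := mem_support_iff.2 (left_ne_zero_of_mul hs)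
  have := le_totalDegree hs'
  rw [Finsupp.sum_add_index' (by simp) (by simp)] at this
  rw [Finsupp.card_toMultiset]
  exact (Nat.le_add_right _ _).trans this

theorem MvPolynomial.hasDerivAt_eval_update {σ : Type*} [Fintype σ] [DecidableEq σ] (i : σ)
    (p : MvPolynomial σ ℝ) (x : σ → ℝ) :
    HasDerivAt (fun t => eval (Function.update x i t) p) (eval x (pderiv i p)) (x i) := by
  induction p using MvPolynomial.induction_on with
  | C a => simpa using hasDerivAt_const (x i) a
  | add p q hp hq => simpa using hp.fun_add hq
  | mul_X p j hp =>
    have hX : HasDerivAt (fun t => eval (Function.update x i t) (X j))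
        (eval x (pderiv i (X j))) (x i) := by
      have := hasDerivAt_pi.1 (hasDerivAt_update x i (x i)) j
      simp only [eval_X, pderiv_X]
      rcases eq_or_ne j i with rfl | hj
      · simpa using this
      · simpa [hj, hj.symm] using this
    have := hp.fun_mul hX
    simp only [Function.update_eq_self] at this
    rw [pderiv_mul]
    simpa using this

open Filter Topology in
theorem MvPolynomial.eval_pderiv_eq_zero_of_isLocalMax {σ : Type*} [Fintype σ]
    {p : MvPolynomial σ ℝ} {x : σ → ℝ} (h : IsLocalMax (fun y => eval y p) x) (i : σ) :
    eval x (pderiv i p) = 0 := by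
  classical
  refine IsLocalMax.hasDerivAt_eq_zero (a := x i) ?_ (hasDerivAt_eval_update i p x)
  have hcont : Continuous fun t : ℝ => Function.update x i t :=
    continuous_const.update i continuous_id
  have hx : Tendsto (fun t : ℝ => Function.update x i t) (𝓝 (x i)) (𝓝 x) := by
    simpa using hcont.tendsto (x i)
  simpa [IsLocalMax, IsMaxFilter] using hx.eventually h

open Asymptotics Filter in
theorem MvPolynomial.eval_isLittleO_norm_pow {σ : Type*} [Fintype σ] [Nonempty σ]
    {p : MvPolynomial σ ℝ} {k : ℕ} (hp : p.totalDegree < k) :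
    (fun x : σ → ℝ => eval x p) =o[cocompact (σ → ℝ)] fun x => ‖x‖ ^ k := by
  simp_rw [eval_eq']
  refine IsLittleO.fun_sum fun s hs => IsLittleO.const_mul_left ?_ _
  have h1 : (fun x : σ → ℝ => ∏ i, x i ^ s i) =O[cocompact (σ → ℝ)]
      fun x => ‖x‖ ^ (∑ i, s i) := by
    refine IsBigO.of_norm_le fun x => ?_
    rw [norm_prod, ← Finset.prod_pow_eq_pow_sum]
    refine Finset.prod_le_prod (fun _ _ => norm_nonneg _) fun i _ => ?_
    rw [norm_pow]
    exact pow_le_pow_left₀ (norm_nonneg _) (norm_le_pi_norm x i) _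
  refine h1.trans_isLittleO ?_
  have h2 : ∑ i, s i < k := by
    have := le_totalDegree hs
    rw [Finsupp.sum_fintype _ _ (by simp)] at this
    omega
  exact (isLittleO_pow_pow_atTop_of_lt h2).comp_tendsto (tendsto_norm_cocompact_atTop)

theorem norm_pow_le_sum_pow {σ : Type*} [Fintype σ] [Nonempty σ] (x : σ → ℝ) {k : ℕ}
    (hk : Even k) : ‖x‖ ^ k ≤ ∑ i, x i ^ k := by
  obtain ⟨i, hi⟩ := Finite.exists_max fun i => ‖x i‖
  have hx : ‖x‖ ≤ ‖x i‖ := (pi_norm_le_iff_of_nonneg (norm_nonneg _)).2 hi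
  calc ‖x‖ ^ k ≤ ‖x i‖ ^ k := pow_le_pow_left₀ (norm_nonneg _) hx _
    _ = x i ^ k := by rw [Real.norm_eq_abs, hk.pow_abs]
    _ ≤ ∑ i, x i ^ k :=
      Finset.single_le_sum (f := fun i => x i ^ k) (fun j _ => hk.pow_nonneg _)
        (Finset.mem_univ i)

open Filter Topology Asymptotics in
/-- A polynomial of degree at most `2 * d` in `#σ` real variables has at most `(2 * d + 1) ^ #σ`
positive nodal domains: subtracting a small multiple of `∑ xᵢ ^ (2 * d + 2)` produces a critical
point in each of them. -/
theorem MvPolynomial.card_pos_components_le {σ ι : Type*} [Fintype σ] [Nonempty σ] [Fintype ι]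
    {h : MvPolynomial σ ℝ} {d : ℕ} (hdeg : h.totalDegree ≤ 2 * d) {p : ι → σ → ℝ}
    (hp : ∀ a, 0 < eval (p a) h)
    (hinj : Function.Injective fun a => connectedComponentIn {x | 0 < eval x h} (p a)) :
    Fintype.card ι ≤ (2 * d + 1) ^ Fintype.card σ := by
  classical
  have hopen : IsOpen {x | 0 < eval x h} := isOpen_lt continuous_const (continuous_eval h)
  obtain ⟨ε, hε, hεp⟩ : ∃ ε : ℝ, 0 < ε ∧
      ∀ a, 0 < eval (p a) h - ε * ∑ i, p a i ^ (2 * d + 2) := by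
    have h1 : ∀ᶠ ε in 𝓝 (0 : ℝ), ∀ a, 0 < eval (p a) h - ε * ∑ i, p a i ^ (2 * d + 2) := by
      refine eventually_all.2 fun a => ?_
      have hc : Continuous fun ε : ℝ => eval (p a) h - ε * ∑ i, p a i ^ (2 * d + 2) := by
        fun_prop
      exact (hc.tendsto 0).eventually_const_lt (by simpa using hp a)
    obtain ⟨ε, h2, h3⟩ := ((h1.filter_mono nhdsWithin_le_nhds).and
      (self_mem_nhdsWithin (a := (0 : ℝ)) (s := Set.Ioi 0))).exists
    exact ⟨ε, h3, h2⟩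
  let F : MvPolynomial σ ℝ := h - C ε * ∑ i, X i ^ (2 * d + 2)
  have hF : ∀ x, eval x F = eval x h - ε * ∑ i, x i ^ (2 * d + 2) := fun x => by simp [F]
  have heven : Even (2 * d + 2) := ⟨d + 1, by ring⟩
  have hFh : ∀ x, 0 < eval x F → 0 < eval x h := fun x hx => by
    rw [hF] at hx
    have := mul_nonneg hε.le
      (Finset.sum_nonneg fun i (_ : i ∈ Finset.univ) => heven.pow_nonneg (x i))
    linarith
  have hlim : ∀ᶠ x in cocompact (σ → ℝ), eval x F ≤ 0 := by
    filter_upwards [(eval_isLittleO_norm_pow (p := h) (k := 2 * d + 2) (by omega)).bound hε]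
      with x hx
    rw [hF]
    rw [Real.norm_eq_abs, Real.norm_of_nonneg (by positivity)] at hx
    have := mul_le_mul_of_nonneg_left (norm_pow_le_sum_pow x heven) hε.le
    linarith [le_abs_self (eval x h)]
  have hmax : ∀ a, ∃ z ∈ connectedComponentIn {x | 0 < eval x h} (p a),
      IsLocalMax (fun x => eval x F) z := by
    intro a
    have hpC : p a ∈ connectedComponentIn {x | 0 < eval x h} (p a) :=
      mem_connectedComponentIn (hp a)
    have hFp : 0 < eval (p a) F := by rw [hF]; exact hεp a
    obtain ⟨z, hz, hzmax⟩ := ContinuousOn.exists_isMaxOn' (continuous_eval F).continuousOn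
      (isClosed_closure (s := connectedComponentIn {x | 0 < eval x h} (p a)))
      (subset_closure hpC)
      ((hlim.filter_mono inf_le_left).mono fun x hx => hx.trans hFp.le)
    have hz0 : 0 < eval z h := hFh z (hFp.trans_le (hzmax (subset_closure hpC)))
    have hzC : z ∈ connectedComponentIn {x | 0 < eval x h} (p a) := by
      refine (IsPreconnected.subset_closure isPreconnected_connectedComponentIn
        (Set.subset_insert z _) (Set.insert_subset hz subset_closure)).subset_connectedComponentIn
        (Set.mem_insert_of_mem z hpC)
        (Set.insert_subset hz0 (connectedComponentIn_subset _ _)) (Set.mem_insert z _)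
    refine ⟨z, hzC, hzmax.isLocalMax ?_⟩
    exact mem_of_superset (hopen.connectedComponentIn.mem_nhds hzC) subset_closure
  choose z hzC hzmax using hmax
  have hz : Function.Injective z := fun a b hab => hinj <| by
    simp only
    rw [connectedComponentIn_eq (hzC a), connectedComponentIn_eq (hzC b), hab]
  refine card_le_of_pow_eq hz (c := ε * (2 * d + 2)) (by positivity) (fun i => pderiv i h)
    (fun i => (totalDegree_pderiv_le i h).trans_lt (by omega)) fun a i => ?_
  have hcrit := eval_pderiv_eq_zero_of_isLocalMax (hzmax a) i
  have hsum : eval (z a) (pderiv i (∑ j, X j ^ (2 * d + 2) : MvPolynomial σ ℝ)) =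
      (2 * d + 2) * z a i ^ (2 * d + 1) := by
    rw [map_sum, Finset.sum_eq_single i]
    · simp
    · intro j _ hj
      simp [pderiv_X_of_ne hj]
    · simp
  simp only [F, map_sub, pderiv_C_mul, map_mul, eval_C] at hcrit
  rw [hsum] at hcrit
  linarith

/-- A polynomial of degree at most `2 * d` in `#σ` real variables has at most
`2 * (2 * d + 1) ^ #σ` nodal domains. -/
theorem MvPolynomial.card_ne_zero_components_le {σ ι : Type*} [Fintype σ] [Nonempty σ] [Fintype ι]
    {h : MvPolynomial σ ℝ} {d : ℕ} (hdeg : h.totalDegree ≤ 2 * d) {p : ι → σ → ℝ}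
    (hp : ∀ a, eval (p a) h ≠ 0)
    (hinj : Function.Injective fun a => connectedComponentIn {x | eval x h ≠ 0} (p a)) :
    Fintype.card ι ≤ 2 * (2 * d + 1) ^ Fintype.card σ := by
  classical
  have aux : ∀ (s : Set (σ → ℝ)), s ⊆ {x | eval x h ≠ 0} → ∀ a b, p b ∈ s →
      connectedComponentIn s (p a) = connectedComponentIn s (p b) → a = b := by
    intro s hs a b hb hab
    refine hinj (connectedComponentIn_eq (connectedComponentIn_mono _ hs ?_))
    rw [hab]
    exact mem_connectedComponentIn hb
  have hpos : Fintype.card {a // 0 < eval (p a) h} ≤ (2 * d + 1) ^ Fintype.card σ :=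
    card_pos_components_le hdeg (p := fun a => p a) (fun a => a.2)
      fun a b hab => Subtype.ext (aux _ (fun x hx => ne_of_gt hx) a b b.2 hab)
  have hneg : Fintype.card {a // ¬ 0 < eval (p a) h} ≤ (2 * d + 1) ^ Fintype.card σ := by
    have hlt : ∀ a : {a // ¬ 0 < eval (p a) h}, 0 < eval (p a) (-h) := fun a => by
      simpa using lt_of_le_of_ne (not_lt.1 a.2) (hp a)
    refine card_pos_components_le (h := -h) (by rwa [totalDegree_neg]) (p := fun a => p a) hlt
      fun a b hab => Subtype.ext (aux _ (fun x hx => ?_) a b (hlt b) hab)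
    have hx' : 0 < eval x (-h) := hx
    rw [map_neg] at hx'
    exact ne_of_lt (neg_pos.1 hx')
  have := Fintype.card_subtype_compl fun a => 0 < eval (p a) h
  have := Fintype.card_subtype_le fun a => 0 < eval (p a) h
  omega

/-- Clearing denominators in a polynomial evaluated at rational functions. -/
theorem MvPolynomial.exists_eval_div {σ τ : Type*} [Fintype τ] {f : MvPolynomial τ ℝ} {d k : ℕ}
    (hf : f.totalDegree ≤ d) (num : τ → MvPolynomial σ ℝ) (den : MvPolynomial σ ℝ)
    (hnum : ∀ i, (num i).totalDegree ≤ k) (hden : den.totalDegree ≤ k) :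
    ∃ h : MvPolynomial σ ℝ, h.totalDegree ≤ k * d ∧ ∀ y, eval y den ≠ 0 →
      eval y h = eval y den ^ d * eval (fun i => eval y (num i) / eval y den) f := by
  have hs : ∀ s ∈ f.support, ∑ i, s i ≤ d := fun s hs => by
    have := le_totalDegree hs
    rw [Finsupp.sum_fintype _ _ (by simp)] at this
    omega
  refine ⟨∑ s ∈ f.support, C (coeff s f) * (den ^ (d - ∑ i, s i) * ∏ i, num i ^ s i),
    totalDegree_finsetSum_le fun s hs' => ?_, fun y hy => ?_⟩
  · refine (totalDegree_mul _ _).trans ?_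
    rw [totalDegree_C, zero_add]
    refine (totalDegree_mul _ _).trans ?_
    calc _ ≤ (d - ∑ i, s i) * k + ∑ i, s i * k := by
          refine add_le_add ((totalDegree_pow _ _).trans (Nat.mul_le_mul_left _ hden))
            ((totalDegree_finsetProd _ _).trans (Finset.sum_le_sum fun i _ => ?_))
          exact (totalDegree_pow _ _).trans (Nat.mul_le_mul_left _ (hnum i))
      _ = k * d := by
          rw [← Finset.sum_mul, ← add_mul, Nat.sub_add_cancel (hs s hs'), mul_comm]
  · rw [eval_eq' _ f, map_sum, Finset.mul_sum]
    refine Finset.sum_congr rfl fun s hs' => ?_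
    simp only [map_mul, eval_C, map_pow, map_prod, div_pow, Finset.prod_div_distrib,
      Finset.prod_pow_eq_pow_sum]
    rw [← pow_sub_mul_pow (eval y den) (hs s hs')]
    field_simp

/-- The numerators of inverse stereographic projection from `(1, 0, …, 0)`, whose common
denominator is `∑ i, X i ^ 2 + 1`. -/
noncomputable def stereoNum (m : ℕ) : Fin (m + 1) → MvPolynomial (Fin m) ℝ :=
  Fin.cons (∑ i, X i ^ 2 - 1) fun i => C 2 * X i

/-- Inverse stereographic projection from `(1, 0, …, 0)`. -/
noncomputable def stereoMap (m : ℕ) (y : Fin m → ℝ) (i : Fin (m + 1)) : ℝ :=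
  eval y (stereoNum m i) / eval y (∑ i, X i ^ 2 + 1)

theorem eval_stereoDen_pos {m : ℕ} (y : Fin m → ℝ) :
    0 < eval y (∑ i, X i ^ 2 + 1 : MvPolynomial (Fin m) ℝ) := by
  simp only [map_add, map_sum, map_pow, eval_X, map_one]
  positivity

theorem stereoMap_zero {m : ℕ} (y : Fin m → ℝ) :
    stereoMap m y 0 = (∑ i, y i ^ 2 - 1) / (∑ i, y i ^ 2 + 1) := by
  simp [stereoMap, stereoNum]

theorem stereoMap_succ {m : ℕ} (y : Fin m → ℝ) (i : Fin m) :
    stereoMap m y i.succ = 2 * y i / (∑ i, y i ^ 2 + 1) := by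
  simp [stereoMap, stereoNum]

theorem continuous_stereoMap (m : ℕ) : Continuous (stereoMap m) :=
  continuous_pi fun _ => (continuous_eval _).div (continuous_eval _)
    fun y => (eval_stereoDen_pos y).ne'

theorem sum_stereoMap_sq {m : ℕ} (y : Fin m → ℝ) : ∑ i, stereoMap m y i ^ 2 = 1 := by
  rw [Fin.sum_univ_succ, stereoMap_zero]
  simp only [stereoMap_succ, div_pow, mul_pow]
  rw [← Finset.sum_div, ← Finset.mul_sum]
  have : 0 ≤ ∑ i, y i ^ 2 := by positivity
  generalize ∑ i, y i ^ 2 = q at *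
  field_simp
  ring

theorem exists_stereoMap_eq {m : ℕ} {x : Fin (m + 1) → ℝ} (hx : ∑ i, x i ^ 2 = 1)
    (hx0 : x 0 ≠ 1) : ∃ y, stereoMap m y = x := by
  have h1 : 1 - x 0 ≠ 0 := sub_ne_zero.2 hx0.symm
  refine ⟨fun i => x i.succ / (1 - x 0), ?_⟩
  rw [Fin.sum_univ_succ] at hx
  have hsum : ∑ i : Fin m, (x i.succ / (1 - x 0)) ^ 2 = (1 + x 0) / (1 - x 0) := by
    simp only [div_pow]
    rw [← Finset.sum_div, eq_sub_of_add_eq' hx]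
    field_simp
    ring
  have hden : (1 + x 0) / (1 - x 0) + 1 = 2 / (1 - x 0) := by
    field_simp
    ring
  ext i
  refine Fin.cases ?_ (fun i => ?_) i
  · rw [stereoMap_zero, hsum, hden]
    field_simp
    ring
  · rw [stereoMap_succ, hsum, hden]
    field_simp

open Filter Topology in
/-- No component of the nonvanishing locus on the sphere of dimension at least one is reduced to
the pole of the stereographic projection. -/
theorem exists_stereoMap_mem_connectedComponentIn {m : ℕ} [NeZero m]
    {f : MvPolynomial (Fin (m + 1)) ℝ} {x : Fin (m + 1) → ℝ}
    (hx : ∑ i, x i ^ 2 = 1) (hfx : eval x f ≠ 0) :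
    ∃ y, stereoMap m y ∈
      connectedComponentIn {x : Fin (m + 1) → ℝ | ∑ i, x i ^ 2 = 1 ∧ eval x f ≠ 0} x := by
  by_cases hx0 : x 0 = 1
  · let γ : ℝ → Fin (m + 1) → ℝ := fun t => Fin.cons (Real.cos t) (Pi.single 0 (Real.sin t))
    have hγ : Continuous γ := by
      refine continuous_pi fun i => Fin.cases ?_ (fun i => ?_) i
      · simpa [γ] using Real.continuous_cos
      · simp only [γ, Fin.cons_succ]
        rcases eq_or_ne i 0 with rfl | hi
        · simpa only [Pi.single_eq_same] using Real.continuous_sin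
        · simpa [hi] using continuous_const
    have hγx : γ 0 = x := by
      rw [Fin.sum_univ_succ, hx0, one_pow, add_eq_left,
        Finset.sum_eq_zero_iff_of_nonneg fun i _ => sq_nonneg _] at hx
      ext i
      refine Fin.cases ?_ (fun i => ?_) i
      · simp [γ, hx0]
      · simpa [γ] using (pow_eq_zero_iff two_ne_zero).1 (hx i (Finset.mem_univ i)) |>.symm
    have hγs : ∀ t, ∑ i, γ t i ^ 2 = 1 := fun t => by
      rw [Fin.sum_univ_succ]
      simp only [γ, Fin.cons_zero, Fin.cons_succ]
      rw [Finset.sum_eq_single 0]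
      · simp
      · intro i _ hi
        simp [hi]
      · simp
    have hev : ∀ᶠ t in 𝓝 (0 : ℝ), eval (γ t) f ≠ 0 :=
      (((continuous_eval f).comp hγ).tendsto 0).eventually_ne (by simpa [hγx] using hfx)
    obtain ⟨δ, hδ, hδf⟩ := Metric.eventually_nhds_iff.1 hev
    let t := min (δ / 2) 1
    have ht : 0 < t := by positivity
    have htδ : t < δ := (min_le_left _ _).trans_lt (half_lt_self hδ)
    have ht1 : t ≤ 1 := min_le_right _ _
    have hmem : γ t ∈
        connectedComponentIn {x : Fin (m + 1) → ℝ | ∑ i, x i ^ 2 = 1 ∧ eval x f ≠ 0} x := by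
      refine (isPreconnected_Icc.image γ hγ.continuousOn).subset_connectedComponentIn
        (s := γ '' Set.Icc 0 t) ⟨0, ⟨le_rfl, ht.le⟩, hγx⟩ ?_ ⟨t, ⟨ht.le, le_rfl⟩, rfl⟩
      rintro _ ⟨s, hs, rfl⟩
      refine ⟨hγs s, hδf ?_⟩
      rw [Real.dist_eq, sub_zero, abs_of_nonneg hs.1]
      exact hs.2.trans_lt htδ
    have hγt : γ t 0 ≠ 1 := by
      have := Real.cos_lt_cos_of_nonneg_of_le_pi le_rfl (by linarith [Real.pi_gt_three]) ht
      rw [Real.cos_zero] at this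
      simpa [γ] using this.ne
    obtain ⟨y, hy⟩ := exists_stereoMap_eq (hγs t) hγt
    exact ⟨y, by rwa [hy]⟩
  · obtain ⟨y, hy⟩ := exists_stereoMap_eq hx hx0
    exact ⟨y, by rw [hy]; exact mem_connectedComponentIn ⟨hx, hfx⟩⟩

/-- (Charron's bound.) For `n ≥ 2`, a polynomial in `n` real variables of
total degree at most `d` (`d ≥ 1`) whose restriction to the unit sphere `S^{n-1}` is not
identically zero has at most `2^{2n−1}·d^{n−1}` nodal domains on `S^{n-1}`. -/
theorem nodal_domains_on_sphere_le
    (n : ℕ) (hn : 2 ≤ n) (d : ℕ) (hd : 1 ≤ d)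
    (f : MvPolynomial (Fin n) ℝ) (hdeg : f.totalDegree ≤ d)
    (hne : ∃ x : Fin n → ℝ, (∑ i, x i ^ 2 = 1) ∧ MvPolynomial.eval x f ≠ 0) :
    Nat.card (ConnectedComponents
      {x : Fin n → ℝ // (∑ i, x i ^ 2 = 1) ∧ MvPolynomial.eval x f ≠ 0}) ≤
      2 ^ (2 * n - 1) * d ^ (n - 1) := by
  obtain ⟨m, rfl⟩ : ∃ m, n = m + 1 := ⟨n - 1, by omega⟩
  have : NeZero m := ⟨by omega⟩
  set U : Set (Fin (m + 1) → ℝ) := {x | ∑ i, x i ^ 2 = 1 ∧ eval x f ≠ 0} with hU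
  change Nat.card (ConnectedComponents U) ≤ _
  cases finite_or_infinite (ConnectedComponents U) with
  | inr _ => simp
  | inl _ =>
  have := Fintype.ofFinite (ConnectedComponents U)
  rw [Nat.card_eq_fintype_card]
  have hquad : (∑ i, X i ^ 2 : MvPolynomial (Fin m) ℝ).totalDegree ≤ 2 :=
    totalDegree_finsetSum_le fun i _ => (totalDegree_X_pow i 2).le
  obtain ⟨h, hhdeg, hh⟩ := exists_eval_div (k := 2) hdeg (stereoNum m) (∑ i, X i ^ 2 + 1)
    (Fin.cases (by simpa [stereoNum] using (totalDegree_sub _ _).trans (by simpa using hquad))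
      fun i => by simpa [stereoNum] using (totalDegree_mul _ _).trans (by simp))
    ((totalDegree_add _ _).trans (by simpa using hquad))
  have hhf : ∀ y, eval y h ≠ 0 ↔ stereoMap m y ∈ U := fun y => by
    have hy := (eval_stereoDen_pos y).ne'
    rw [hh y hy, mul_ne_zero_iff]
    exact ⟨fun hf => ⟨sum_stereoMap_sq y, hf.2⟩, fun hf => ⟨pow_ne_zero _ hy, hf.2⟩⟩
  let Φ : {y | eval y h ≠ 0} → U := fun y => ⟨stereoMap m y, (hhf y).1 y.2⟩
  have hΦ : Continuous Φ := ((continuous_stereoMap m).comp continuous_subtype_val).subtype_mk _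
  have hsurj : ∀ c : ConnectedComponents U, ∃ y, (Φ y : ConnectedComponents U) = c := by
    intro c
    obtain ⟨x, rfl⟩ := ConnectedComponents.surjective_coe c
    obtain ⟨y, hy⟩ := exists_stereoMap_mem_connectedComponentIn x.2.1 x.2.2
    refine ⟨⟨y, (hhf y).2 (connectedComponentIn_subset _ _ hy)⟩, ?_⟩
    change _ ∈ connectedComponentIn U x at hy
    rw [connectedComponentIn_eq_image x.2] at hy
    obtain ⟨x', hx', hxy⟩ := hy
    rw [ConnectedComponents.coe_eq_coe']
    convert hx'
    exact Subtype.ext hxy.symm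
  choose y hy using hsurj
  have hcard := card_ne_zero_components_le (p := fun c => (y c : Fin m → ℝ)) hhdeg
    (fun c => (y c).2) fun a b hab => by
      have hmem : (y a : Fin m → ℝ) ∈ connectedComponentIn {x | eval x h ≠ 0} (y b) := by
        rw [← show connectedComponentIn _ _ = connectedComponentIn _ _ from hab]
        exact mem_connectedComponentIn (y a).2
      rw [connectedComponentIn_eq_image (y b).2] at hmem
      obtain ⟨w, hw, hwy⟩ := hmem
      obtain rfl : w = y a := Subtype.ext hwy
      rw [← hy a, ← hy b, ConnectedComponents.coe_eq_coe']
      exact hΦ.image_connectedComponent_subset _ ⟨_, hw, rfl⟩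
  rw [Fintype.card_fin] at hcard
  calc _ ≤ 2 * (2 * d + 1) ^ m := hcard
    _ ≤ 2 * (4 * d) ^ m := Nat.mul_le_mul_left _ (Nat.pow_le_pow_left (by omega) _)
    _ = 2 ^ (2 * (m + 1) - 1) * d ^ (m + 1 - 1) := by
      rw [show 2 * (m + 1) - 1 = 2 * m + 1 by omega, Nat.add_sub_cancel, mul_pow, pow_succ,
        pow_mul]
      norm_num
      ring
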